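/- Let E be a finite-dimensional real inner product space of dimension m ≥ 1 and Φ : E → ℝ a Lipschitz function. If p ∈ E is nonsingular for Φ in the sense of Clarke, then there exist constants λ > 0 and ε₀ > 0 such that for every ε ∈ (0, ε₀) the mollified function Φ_ε has nonvanishing derivative on the open ball B(p, λ): fderiv ℝ Φ_ε x ≠ 0 for all x ∈ B(p, λ). In particular, Φ_ε has no critical points on B(p, λ) for all sufficiently small ε > 0. -/

import Mathlib

open Filter Topology MeasureTheory

/-- The mixture of the differential of a Lipschitz function `Φ : E → ℝ` at `p`:
all operator-norm limits of `fderiv ℝ Φ xᵢ` along sequences of differentiability points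
`xᵢ → p`. -/
def mixture {E : Type*} [NormedAddCommGroup E] [NormedSpace ℝ E] (Φ : E → ℝ) (p : E) :
    Set (E →L[ℝ] ℝ) :=
  {G : E →L[ℝ] ℝ | ∃ x : ℕ → E, (∀ i, DifferentiableAt ℝ Φ (x i)) ∧
    Tendsto x atTop (𝓝 p) ∧ Tendsto (fun i => fderiv ℝ Φ (x i)) atTop (𝓝 G)}

/-- The Clarke generalized differential of `Φ` at `p`. -/
def clarke {E : Type*} [NormedAddCommGroup E] [NormedSpace ℝ E] (Φ : E → ℝ) (p : E) :
    Set (E →L[ℝ] ℝ) :=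
  convexHull ℝ (mixture Φ p)

/-- The mollification of `Φ` by the rescaled kernel `ρ_ε(y) = ε^{-m} ρ(ε⁻¹ y)`:
`Φ_ε(q) = ∫ ρ_ε(y) • Φ(q - y) dy`. -/
noncomputable def mollify {m : ℕ} {F : Type*} [NormedAddCommGroup F] [NormedSpace ℝ F]
    (ρ : EuclideanSpace ℝ (Fin m) → ℝ) (ε : ℝ)
    (Φ : EuclideanSpace ℝ (Fin m) → F) (q : EuclideanSpace ℝ (Fin m)) : F :=
  ∫ y : EuclideanSpace ℝ (Fin m), ((ε ^ m)⁻¹ * ρ (ε⁻¹ • y)) • Φ (q - y)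

section Mixture

variable {E : Type*} [NormedAddCommGroup E] [NormedSpace ℝ E]

theorem mem_mixture_iff_mem_closure {Φ : E → ℝ} {p : E} {G : E →L[ℝ] ℝ} :
    G ∈ mixture Φ p ↔
      (p, G) ∈ closure ((fun x => (x, fderiv ℝ Φ x)) '' {x | DifferentiableAt ℝ Φ x}) := by
  rw [mem_closure_iff_seq_limit]
  constructor
  · rintro ⟨x, hx, hxp, hxG⟩
    exact ⟨fun i => (x i, fderiv ℝ Φ (x i)), fun i => ⟨x i, hx i, rfl⟩, hxp.prodMk_nhds hxG⟩
  · rintro ⟨z, hz, hzG⟩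
    choose x hx hxz using hz
    obtain rfl : (fun i => (x i, fderiv ℝ Φ (x i))) = z := funext hxz
    exact ⟨x, hx, hzG.fst_nhds, hzG.snd_nhds⟩

theorem isClosed_mixture (Φ : E → ℝ) (p : E) : IsClosed (mixture Φ p) := by
  have : mixture Φ p = (fun G : E →L[ℝ] ℝ => (p, G)) ⁻¹'
      closure ((fun x => (x, fderiv ℝ Φ x)) '' {x | DifferentiableAt ℝ Φ x}) :=
    Set.ext fun _ => mem_mixture_iff_mem_closure
  rw [this]
  exact isClosed_closure.preimage (by fun_prop)

variable [FiniteDimensional ℝ E] {Φ : E → ℝ} {L : NNReal}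

theorem LipschitzWith.isCompact_mixture (hΦ : LipschitzWith L Φ) (p : E) :
    IsCompact (mixture Φ p) := by
  refine (isCompact_closedBall (0 : E →L[ℝ] ℝ) L).of_isClosed_subset (isClosed_mixture Φ p) ?_
  rintro G ⟨x, -, -, hG⟩
  exact Metric.isClosed_closedBall.mem_of_tendsto hG
    (.of_forall fun i => by simpa using norm_fderiv_le_of_lipschitz ℝ hΦ)

/-- The differential of a Lipschitz function near `p` takes values in any prescribed neighbourhood
of the mixture at `p`. -/
theorem LipschitzWith.eventually_fderiv_mem (hΦ : LipschitzWith L Φ) {p : E}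
    {U : Set (E →L[ℝ] ℝ)} (hU : IsOpen U) (hp : mixture Φ p ⊆ U) :
    ∀ᶠ x in 𝓝 p, DifferentiableAt ℝ Φ x → fderiv ℝ Φ x ∈ U := by
  by_contra h
  obtain ⟨x, hxp, hx⟩ := exists_seq_forall_of_frequently (not_eventually.1 h)
  push Not at hx
  obtain ⟨G, -, φ, hφ, hG⟩ := (isCompact_closedBall (0 : E →L[ℝ] ℝ) L).tendsto_subseq
    (x := fun i => fderiv ℝ Φ (x i)) fun i => by simpa using norm_fderiv_le_of_lipschitz ℝ hΦ
  have hGU : G ∉ U := hU.isClosed_compl.mem_of_tendsto hG (.of_forall fun i => (hx (φ i)).2)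
  exact hGU (hp ⟨x ∘ φ, fun i => (hx (φ i)).1, hxp.comp hφ.tendsto_atTop, hG⟩)

end Mixture

/-- In finite dimension the convex hull of a compact set is compact, by Carathéodory's theorem. -/
theorem IsCompact.convexHull_of_finiteDimensional {E : Type*} [NormedAddCommGroup E]
    [NormedSpace ℝ E] [FiniteDimensional ℝ E] {K : Set E} (hK : IsCompact K) :
    IsCompact (convexHull ℝ K) := by
  let S : ℕ → Set E := fun n => (fun q : (Fin n → ℝ) × (Fin n → E) => ∑ i, q.1 i • q.2 i) ''
    (stdSimplex ℝ (Fin n) ×ˢ Set.univ.pi fun _ => K)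
  have hS : convexHull ℝ K = ⋃ n ∈ Finset.range (Module.finrank ℝ E + 2), S n := by
    refine Set.Subset.antisymm (fun x hx => ?_) (Set.iUnion₂_subset fun n _ => ?_)
    · obtain ⟨ι, _, z, w, hz, hzi, hw, hw1, rfl⟩ := eq_pos_convex_span_of_mem_convexHull hx
      have hcard : Fintype.card ι ≤ Module.finrank ℝ E + 1 :=
        hzi.card_le_finrank_succ.trans (by gcongr; exact Submodule.finrank_le _)
      let e := (Fintype.equivFin ι).symm
      refine Set.mem_biUnion (Finset.mem_coe.2 (Finset.mem_range.2 (Nat.lt_succ_of_le hcard)))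
        ⟨(w ∘ e, z ∘ e), ⟨⟨fun i => (hw _).le, ?_⟩, fun i _ => hz ⟨e i, rfl⟩⟩, ?_⟩
      · exact (e.sum_comp w).trans hw1
      · exact e.sum_comp fun i => w i • z i
    · rintro _ ⟨⟨w, z⟩, ⟨hw, hz⟩, rfl⟩
      exact (convex_convexHull ℝ K).sum_mem (fun i _ => hw.1 i) hw.2
        fun i _ => subset_convexHull ℝ K (hz i trivial)
  rw [hS]
  exact (Finset.range _).isCompact_biUnion fun n _ =>
    ((isCompact_stdSimplex ℝ (Fin n)).prod (isCompact_univ_pi fun _ => hK)).image (by fun_prop)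

/-- At a nonsingular point all generalized differentials are uniformly positive in a common
direction. -/
theorem LipschitzWith.exists_forall_mixture_lt_apply {E : Type*} [NormedAddCommGroup E]
    [NormedSpace ℝ E] [FiniteDimensional ℝ E] {Φ : E → ℝ} {L : NNReal}
    (hΦ : LipschitzWith L Φ) {p : E} (hp : ∀ g ∈ clarke Φ p, g ≠ 0) :
    ∃ v : E, ∃ c > (0 : ℝ), ∀ g ∈ mixture Φ p, c < g v := by
  obtain ⟨f, c, hc, hf⟩ := geometric_hahn_banach_point_closed
    (convex_convexHull ℝ (mixture Φ p))
    (hΦ.isCompact_mixture p).convexHull_of_finiteDimensional.isClosed fun h => hp 0 h rfl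
  let v : E := (Module.evalEquiv ℝ E).symm
    (f.toLinearMap ∘ₗ (LinearMap.toContinuousLinearMap (𝕜 := ℝ) (E := E) (F' := ℝ)).toLinearMap)
  refine ⟨v, c, by simpa using hc, fun g hg => ?_⟩
  have key : g v = f g := Module.apply_evalEquiv_symm_apply ℝ E (g : Module.Dual ℝ E) _
  exact key ▸ hf g (subset_convexHull ℝ _ hg)

/-- A convolution of a Lipschitz function with a continuous compactly supported weight is
differentiated under the integral sign. -/
theorem LipschitzWith.hasFDerivAt_integral_smul_comp_sub {E : Type*} [NormedAddCommGroup E]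
    [NormedSpace ℝ E] [FiniteDimensional ℝ E] [MeasurableSpace E] [BorelSpace E]
    {μ : Measure E} [μ.IsAddHaarMeasure] {w Φ : E → ℝ} {L : NNReal} (hΦ : LipschitzWith L Φ)
    (hw : Continuous w) (hw' : HasCompactSupport w) (x : E) :
    Integrable (fun y => w y • fderiv ℝ Φ (x - y)) μ ∧
      HasFDerivAt (fun q => ∫ y, w y • Φ (q - y) ∂μ) (∫ y, w y • fderiv ℝ Φ (x - y) ∂μ) x := by
  have hcont : ∀ q, Continuous fun y => w y • Φ (q - y) := fun q =>
    hw.smul (hΦ.continuous.comp (continuous_const.sub continuous_id))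
  refine hasFDerivAt_integral_of_dominated_loc_of_lip' (bound := fun y => ‖w y‖ * L) univ_mem
    (fun q _ => (hcont q).aestronglyMeasurable)
    ((hcont x).integrable_of_hasCompactSupport hw'.smul_right) ?_ (.of_forall fun y q _ => ?_)
    ((hw.integrable_of_hasCompactSupport hw').norm.mul_const _) ?_
  · exact hw.aestronglyMeasurable.smul
      ((measurable_fderiv ℝ Φ).comp (measurable_const.sub measurable_id)).aestronglyMeasurable
  · rw [← smul_sub, norm_smul, mul_assoc]
    gcongr
    simpa using hΦ.norm_sub_le (q - y) (x - y)
  · have h := (quasiMeasurePreserving_sub_left_of_right_invariant μ x).ae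
      (hΦ.ae_differentiableAt (μ := μ))
    filter_upwards [h] with y hy
    exact (hy.hasFDerivAt.comp x ((hasFDerivAt_id x).sub_const y)).const_smul (w y)

theorem stmt_15 {m : ℕ} (hm : 1 ≤ m)
    (ρ : EuclideanSpace ℝ (Fin m) → ℝ)
    (hρ_smooth : ContDiff ℝ (⊤ : ℕ∞) ρ) (hρ_nonneg : ∀ y, 0 ≤ ρ y)
    (hρ_supp : Function.support ρ ⊆ Metric.closedBall 0 1)
    (hρ_int : ∫ y : EuclideanSpace ℝ (Fin m), ρ y = 1)
    (Φ : EuclideanSpace ℝ (Fin m) → ℝ) (L : NNReal) (hΦ : LipschitzWith L Φ)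
    (p : EuclideanSpace ℝ (Fin m))
    (hp : ∀ g ∈ clarke Φ p, g ≠ 0) :
    ∃ lam > (0 : ℝ), ∃ ε₀ > (0 : ℝ), ∀ ε : ℝ, 0 < ε → ε < ε₀ →
      ∀ x ∈ Metric.ball p lam, fderiv ℝ (mollify ρ ε Φ) x ≠ 0 := by
  obtain ⟨v, c, hc, hv⟩ := hΦ.exists_forall_mixture_lt_apply hp
  have hU : IsOpen {g : EuclideanSpace ℝ (Fin m) →L[ℝ] ℝ | c < g v} :=
    isOpen_lt continuous_const (by fun_prop)
  obtain ⟨δ, hδ, hball⟩ := Metric.eventually_nhds_iff.1 (hΦ.eventually_fderiv_mem hU hv)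
  refine ⟨δ / 2, by positivity, δ / 2, by positivity, fun ε hε hεδ x hx h0 => ?_⟩
  set w : EuclideanSpace ℝ (Fin m) → ℝ := fun y => (ε ^ m)⁻¹ * ρ (ε⁻¹ • y) with hw_def
  have hw_nonneg : ∀ y, 0 ≤ w y := fun y => mul_nonneg (by positivity) (hρ_nonneg _)
  have hw_supp : ∀ y, w y ≠ 0 → ‖y‖ ≤ ε := fun y hy => by
    have := hρ_supp (right_ne_zero_of_mul hy)
    rwa [mem_closedBall_zero_iff, norm_smul, norm_inv, Real.norm_of_nonneg hε.le,
      inv_mul_le_iff₀ hε, mul_one] at this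
  have hw_cont : Continuous w :=
    continuous_const.mul (hρ_smooth.continuous.comp (continuous_const_smul _))
  have hw_cpt : HasCompactSupport w := .intro (isCompact_closedBall 0 ε) fun y hy => by
    contrapose! hy
    simpa using hw_supp y hy
  have hw_int : ∫ y, w y = 1 := by
    rw [integral_const_mul, Measure.integral_comp_inv_smul_of_nonneg _ _ hε.le, hρ_int]
    simp [hε.ne']
  obtain ⟨hint, hderiv⟩ := hΦ.hasFDerivAt_integral_smul_comp_sub (μ := volume) hw_cont hw_cpt x
  have hzero : ∫ y, w y • fderiv ℝ Φ (x - y) = 0 := hderiv.fderiv.symm.trans h0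
  have hdiff := (quasiMeasurePreserving_sub_left_of_right_invariant volume x).ae
    (hΦ.ae_differentiableAt (μ := volume))
  have hle : ∫ y, w y * c ≤ ∫ y, (w y • fderiv ℝ Φ (x - y)) v := by
    refine integral_mono_ae ((hw_cont.integrable_of_hasCompactSupport hw_cpt).mul_const c)
      (hint.apply_continuousLinearMap v) ?_
    filter_upwards [hdiff] with y hy
    rcases eq_or_ne (w y) 0 with hwy | hwy
    · simp [hwy]
    · refine mul_le_mul_of_nonneg_left (hball ?_ hy).le (hw_nonneg y)
      have h1 : dist (x - y) x ≤ ε := by simpa using hw_supp y hwy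
      linarith [dist_triangle (x - y) x p, Metric.mem_ball.1 hx]
  rw [← ContinuousLinearMap.integral_apply hint, hzero, integral_mul_const, hw_int] at hle
  simp at hle
  linarith
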